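/- arXiv:1907.10101 — 2 statements merged into one kernel-verified Lean document; each statement's English description precedes it below -/
import Mathlib

section
/- In any routing game in which every edge cost c_e is continuous and strictly increasing, if μ₀ > 0 is a regular demand then the active network is locally constant at μ₀: there exists ε > 0 such that Ẽ(μ) = Ẽ(μ₀) for all μ ∈ (μ₀−ε, μ₀+ε) ∩ (0,∞). -/
open Finset Set

noncomputable section

variable {E P : Type*}

/-- The load induced on edge `e` by a path-flow `f`. -/
def edgeLoad [Fintype P] [DecidableEq E] (path : P → Finset E) (f : P → ℝ) (e : E) : ℝ :=
  ∑ p, if e ∈ path p then f p else 0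

/-- A flow is feasible for demand `μ` if it is nonnegative and routes total demand `μ`. -/
def Feasible [Fintype P] (f : P → ℝ) (μ : ℝ) : Prop :=
  (∀ p, 0 ≤ f p) ∧ ∑ p, f p = μ

/-- The cost of path `p` under flow `f`. -/
def pathCost [Fintype P] [DecidableEq E] (path : P → Finset E) (c : E → ℝ → ℝ)
    (f : P → ℝ) (p : P) : ℝ :=
  ∑ e ∈ path p, c e (edgeLoad path f e)

/-- Wardrop equilibrium with equilibrium cost `lam` at demand `μ`. -/
def IsWardrop [Fintype P] [DecidableEq E] (path : P → Finset E) (c : E → ℝ → ℝ)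
    (μ : ℝ) (f : P → ℝ) (lam : ℝ) : Prop :=
  Feasible f μ ∧ (∀ p, 0 < f p → pathCost path c f p = lam) ∧
    ∀ p, lam ≤ pathCost path c f p

/-- Social cost of a flow. -/
def socialCost [Fintype E] [Fintype P] [DecidableEq E] (path : P → Finset E)
    (c : E → ℝ → ℝ) (f : P → ℝ) : ℝ :=
  ∑ e, edgeLoad path f e * c e (edgeLoad path f e)

/-- The active network: edges lying on some path of cost `lam` (the minimal cost). -/
def activeNet [Fintype P] [DecidableEq E] (path : P → Finset E) (c : E → ℝ → ℝ)
    (f : P → ℝ) (lam : ℝ) : Set E :=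
  {e | ∃ p, pathCost path c f p = lam ∧ e ∈ path p}

/-- `μ₀` is a breakpoint of the active-network map `Act`. -/
def IsBreakpoint (Act : ℝ → Set E) (μ₀ : ℝ) : Prop :=
  0 < μ₀ ∧ ∃ ε > 0,
    (∀ μ ∈ Set.Ico (μ₀ - ε) μ₀, Act μ = Act (μ₀ - ε)) ∧
    (∀ μ ∈ Set.Ioc μ₀ (μ₀ + ε), Act μ = Act (μ₀ + ε)) ∧
    Act (μ₀ - ε) ≠ Act (μ₀ + ε)

/-- A demand `μ > 0` is regular if some Wardrop equilibrium at `μ` puts strictly positive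
load on every edge of the active network. -/
def RegularDemand [Fintype P] [DecidableEq E] (path : P → Finset E) (c : E → ℝ → ℝ)
    (μ : ℝ) : Prop :=
  ∃ f lam, IsWardrop path c μ f lam ∧
    ∀ e ∈ activeNet path c f lam, 0 < edgeLoad path f e

open Filter Topology

section Auxiliary

variable [Fintype P] [DecidableEq E] {path : P → Finset E} {c : E → ℝ → ℝ}

theorem Feasible.edgeLoad_le {f : P → ℝ} {μ : ℝ} (hf : Feasible f μ) (e : E) :
    edgeLoad path f e ≤ μ := by
  rw [← hf.2]
  refine Finset.sum_le_sum fun p _ => ?_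
  split_ifs
  exacts [le_rfl, hf.1 p]

theorem exists_pos_flow_of_edgeLoad_pos {f : P → ℝ} {e : E} (h : 0 < edgeLoad path f e) :
    ∃ p, e ∈ path p ∧ 0 < f p := by
  by_contra! hneg
  refine h.not_ge (Finset.sum_nonpos fun p _ => ?_)
  split_ifs with hp
  exacts [hneg p hp, le_rfl]

theorem Feasible.exists_pos_flow {f : P → ℝ} {μ : ℝ} (hf : Feasible f μ) (hμ : 0 < μ) :
    ∃ p, 0 < f p := by
  by_contra! hneg
  exact (hf.2 ▸ hμ).not_ge (Finset.sum_nonpos fun p _ => hneg p)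

/-- Summing edge costs against loads is the same as summing path costs against flows. -/
theorem sum_mul_edgeLoad [Fintype E] (t : E → ℝ) (f : P → ℝ) :
    ∑ e, t e * edgeLoad path f e = ∑ p, (∑ e ∈ path p, t e) * f p := by
  simp only [edgeLoad, Finset.mul_sum, Finset.sum_mul]
  rw [Finset.sum_comm]
  refine Finset.sum_congr rfl fun p _ => ?_
  simp [Finset.sum_ite_mem]

theorem IsWardrop.sum_cost_mul_edgeLoad [Fintype E] {μ lam : ℝ} {f : P → ℝ}
    (hf : IsWardrop path c μ f lam) :
    ∑ e, c e (edgeLoad path f e) * edgeLoad path f e = lam * μ := by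
  rw [sum_mul_edgeLoad (fun e => c e (edgeLoad path f e)), ← hf.1.2, Finset.mul_sum]
  refine Finset.sum_congr rfl fun p _ => ?_
  rcases (hf.1.1 p).eq_or_lt with h | h
  · simp [← h]
  · rw [← hf.2.1 p h, pathCost]

theorem IsWardrop.le_sum_cost_mul_edgeLoad [Fintype E] {μ ν lam : ℝ} {f g : P → ℝ}
    (hf : IsWardrop path c μ f lam) (hg : Feasible g ν) :
    lam * ν ≤ ∑ e, c e (edgeLoad path f e) * edgeLoad path g e := by
  rw [sum_mul_edgeLoad (fun e => c e (edgeLoad path f e)), ← hg.2, Finset.mul_sum]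
  exact Finset.sum_le_sum fun p _ => mul_le_mul_of_nonneg_right (hf.2.2 p) (hg.1 p)

/-- Monotonicity of equilibria: the edgewise products of cost and load differences are
controlled by the change in equilibrium cost and demand. -/
theorem IsWardrop.sum_cost_sub_mul_load_sub_le [Fintype E] {μ ν lam lam' : ℝ} {f g : P → ℝ}
    (hf : IsWardrop path c μ f lam) (hg : IsWardrop path c ν g lam') :
    ∑ e, (c e (edgeLoad path g e) - c e (edgeLoad path f e)) *
      (edgeLoad path g e - edgeLoad path f e) ≤ (lam' - lam) * (ν - μ) := by
  have hff := hf.sum_cost_mul_edgeLoad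
  have hgg := hg.sum_cost_mul_edgeLoad
  have hfg := hf.le_sum_cost_mul_edgeLoad hg.1
  have hgf := hg.le_sum_cost_mul_edgeLoad hf.1
  simp only [sub_mul, mul_sub, Finset.sum_sub_distrib]
  linarith

theorem IsWardrop.cost_nonneg (hc : ∀ e x, 0 ≤ c e x) {μ lam : ℝ} {f : P → ℝ}
    (hf : IsWardrop path c μ f lam) (hμ : 0 < μ) : 0 ≤ lam := by
  obtain ⟨p, hp⟩ := hf.1.exists_pos_flow hμ
  rw [← hf.2.1 p hp]
  exact Finset.sum_nonneg fun e _ => hc e _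

theorem IsWardrop.cost_le (hc : ∀ e, Monotone (c e)) {μ lam b : ℝ} {f : P → ℝ}
    (hf : IsWardrop path c μ f lam) (hb : μ ≤ b) (p : P) : lam ≤ ∑ e ∈ path p, c e b :=
  (hf.2.2 p).trans <| Finset.sum_le_sum fun e _ => hc e ((hf.1.edgeLoad_le e).trans hb)

theorem StrictMono.tendsto_of_tendsto_sub_mul_sub {α : Type*} {l : Filter α} {h : ℝ → ℝ}
    (hh : StrictMono h) {y : α → ℝ} {x : ℝ}
    (hy : Tendsto (fun a => (h (y a) - h x) * (y a - x)) l (𝓝 0)) : Tendsto y l (𝓝 x) := by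
  rw [tendsto_order]
  constructor
  · intro b hb
    have hpos : 0 < (h x - h b) * (x - b) := mul_pos (sub_pos.2 (hh hb)) (sub_pos.2 hb)
    filter_upwards [hy.eventually_lt_const hpos] with a ha
    by_contra! hle
    have hmul : (h x - h b) * (x - b) ≤ (h x - h (y a)) * (x - y a) :=
      mul_le_mul (sub_le_sub_left (hh.monotone hle) _) (sub_le_sub_left hle _)
        (sub_pos.2 hb).le (sub_nonneg.2 (hh.monotone (hle.trans hb.le)))
    linarith
  · intro b hb
    have hpos : 0 < (h b - h x) * (b - x) := mul_pos (sub_pos.2 (hh hb)) (sub_pos.2 hb)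
    filter_upwards [hy.eventually_lt_const hpos] with a ha
    by_contra! hle
    have hmul : (h b - h x) * (b - x) ≤ (h (y a) - h x) * (y a - x) :=
      mul_le_mul (sub_le_sub_right (hh.monotone hle) _) (sub_le_sub_right hle _)
        (sub_pos.2 hb).le (sub_nonneg.2 (hh.monotone (hb.le.trans hle)))
    linarith

/-- Equilibrium edge loads depend continuously on the demand. -/
theorem tendsto_edgeLoad_of_isWardrop [Fintype E] [Nonempty P] (hc_nonneg : ∀ e x, 0 ≤ c e x)
    (hc_strict : ∀ e, StrictMono (c e)) {feq : ℝ → P → ℝ} {lamf : ℝ → ℝ}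
    (hfeq : ∀ μ : ℝ, 0 < μ → IsWardrop path c μ (feq μ) (lamf μ))
    {μ₀ lam : ℝ} (hμ₀ : 0 < μ₀) {f : P → ℝ} (hf : IsWardrop path c μ₀ f lam) (e : E) :
    Tendsto (fun μ => edgeLoad path (feq μ) e) (𝓝 μ₀) (𝓝 (edgeLoad path f e)) := by
  obtain ⟨p⟩ := ‹Nonempty P›
  have hterm : ∀ (g : P → ℝ) (e : E), 0 ≤ (c e (edgeLoad path g e) - c e (edgeLoad path f e)) *
      (edgeLoad path g e - edgeLoad path f e) := by
    intro g e
    rcases le_total (edgeLoad path g e) (edgeLoad path f e) with h | h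
    · exact mul_nonneg_of_nonpos_of_nonpos
        (sub_nonpos.2 ((hc_strict e).monotone h)) (sub_nonpos.2 h)
    · exact mul_nonneg (sub_nonneg.2 ((hc_strict e).monotone h)) (sub_nonneg.2 h)
  refine (hc_strict e).tendsto_of_tendsto_sub_mul_sub ?_
  have hbound : Tendsto (fun μ => ((∑ e ∈ path p, c e (μ₀ + 1)) + lam) * |μ - μ₀|)
      (𝓝 μ₀) (𝓝 0) := by
    have hcont : Continuous fun μ => ((∑ e ∈ path p, c e (μ₀ + 1)) + lam) * |μ - μ₀| := by
      fun_prop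
    simpa using hcont.tendsto μ₀
  refine tendsto_of_tendsto_of_tendsto_of_le_of_le' tendsto_const_nhds hbound
    (Eventually.of_forall fun μ => hterm (feq μ) e) ?_
  filter_upwards [lt_mem_nhds hμ₀, gt_mem_nhds (lt_add_one μ₀)] with μ hμ hμ1
  have hg := hfeq μ hμ
  have hlam := hf.cost_nonneg hc_nonneg hμ₀
  have hlam' := hg.cost_nonneg hc_nonneg hμ
  have hle := hg.cost_le (fun e => (hc_strict e).monotone) hμ1.le p
  have habs : |lamf μ - lam| ≤ (∑ e ∈ path p, c e (μ₀ + 1)) + lam :=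
    abs_le.2 ⟨by linarith, by linarith⟩
  calc _ ≤ _ := Finset.single_le_sum (fun e _ => hterm (feq μ) e) (Finset.mem_univ e)
    _ ≤ (lamf μ - lam) * (μ - μ₀) := hf.sum_cost_sub_mul_load_sub_le hg
    _ ≤ |lamf μ - lam| * |μ - μ₀| := (le_abs_self _).trans (abs_mul _ _).le
    _ ≤ _ := mul_le_mul_of_nonneg_right habs (abs_nonneg _)

end Auxiliary

/-- with continuous strictly increasing costs, the active network is locally
constant at every regular demand `μ₀ > 0`. -/
theorem active_network_locally_constant_at_regular
    [Fintype E] [DecidableEq E] [Nonempty E] [Fintype P] [Nonempty P]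
    (path : P → Finset E) (hpath : ∀ p, (path p).Nonempty)
    (c : E → ℝ → ℝ)
    (hc_cont : ∀ e, Continuous (c e))
    (hc_nonneg : ∀ e x, 0 ≤ c e x)
    (hc_strict : ∀ e, StrictMono (c e))
    (feq : ℝ → P → ℝ) (lamf : ℝ → ℝ)
    (hfeq : ∀ μ : ℝ, 0 < μ → IsWardrop path c μ (feq μ) (lamf μ))
    (μ₀ : ℝ) (hμ₀ : 0 < μ₀) (hreg : RegularDemand path c μ₀) :
    ∃ ε > 0, ∀ μ ∈ Set.Ioo (μ₀ - ε) (μ₀ + ε), 0 < μ →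
      activeNet path c (feq μ) (lamf μ) = activeNet path c (feq μ₀) (lamf μ₀) := by
  obtain ⟨f, lam, hf, hpos⟩ := hreg
  have hload := tendsto_edgeLoad_of_isWardrop hc_nonneg hc_strict hfeq hμ₀ hf
  have hcost : ∀ p, Tendsto (fun μ => pathCost path c (feq μ) p) (𝓝 μ₀)
      (𝓝 (pathCost path c f p)) := fun p =>
    tendsto_finsetSum _ fun e _ => ((hc_cont e).tendsto _).comp (hload e)
  obtain ⟨q, hq⟩ := hf.1.exists_pos_flow hμ₀
  have hinactive : ∀ᶠ μ in 𝓝 μ₀, ∀ p, lam < pathCost path c f p →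
      pathCost path c (feq μ) q < pathCost path c (feq μ) p := by
    refine eventually_all.2 fun p => ?_
    by_cases hp : lam < pathCost path c f p
    · filter_upwards [(hcost q).eventually_lt (hcost p) (by rwa [hf.2.1 q hq])] with μ h _
      exact h
    · exact Eventually.of_forall fun _ h => absurd h hp
  have hloaded : ∀ᶠ μ in 𝓝 μ₀, ∀ e, e ∈ activeNet path c f lam →
      0 < edgeLoad path (feq μ) e := by
    refine eventually_all.2 fun e => ?_
    by_cases he : e ∈ activeNet path c f lam
    · filter_upwards [(hload e).eventually_const_lt (hpos e he)] with μ h _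
      exact h
    · exact Eventually.of_forall fun _ h => absurd h he
  have hact : ∀ᶠ μ in 𝓝 μ₀,
      activeNet path c (feq μ) (lamf μ) = activeNet path c f lam := by
    filter_upwards [hinactive, hloaded, lt_mem_nhds hμ₀] with μ hin hl hμ
    have hg := hfeq μ hμ
    ext e
    constructor
    · rintro ⟨p, hp, hep⟩
      refine ⟨p, le_antisymm ?_ (hf.2.2 p), hep⟩
      by_contra! hlt
      exact ((hin p hlt).trans_eq hp).not_ge (hg.2.2 q)
    · intro he
      obtain ⟨p, hep, hp⟩ := exists_pos_flow_of_edgeLoad_pos (hl e he)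
      exact ⟨p, hg.2.1 p hp, hep⟩
  obtain ⟨ε, hε, hball⟩ := Metric.eventually_nhds_iff_ball.1 hact
  refine ⟨ε, hε, fun μ hμ _ => ?_⟩
  rw [hball μ (by rwa [Real.ball_eq_Ioo]), hact.self_of_nhds]
end
end

section
/- There exists a routing game with continuous, nonnegative, nondecreasing edge costs and demands 0 < μ¹ < μ² < μ³ such that Ẽ(μ¹) = Ẽ(μ³) and Ẽ(μ²) ≠ Ẽ(μ¹); that is, an active network that is abandoned at some demand level can reappear at a strictly higher demand level. Such an example is given by the Wheatstone network with edge set E = {e₁, e₂, e₃, e₄, e₅}, path set P = {{e₁,e₄}, {e₂,e₅}, {e₁,e₃,e₅}}, costs c_{e₁}(x) = c_{e₅}(x) = x, c_{e₃}(x) = 0, and c_{e₂} = c_{e₄} = c, where c is any continuous nondecreasing function with c ≡ a on [0,ζ] and c ≡ b on [ζ+η,∞) for constants satisfying 0 < η < a < ζ < ζ+η < b. -/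
open Finset Set

noncomputable section

variable {E P : Type*}

/-- Total path cost of a flow `g`, priced by the edge costs of `f`, summed edge by edge. -/
theorem sum_mul_pathCost [Fintype E] [Fintype P] [DecidableEq E] (path : P → Finset E)
    (c : E → ℝ → ℝ) (f g : P → ℝ) :
    ∑ p, g p * pathCost path c f p = ∑ e, edgeLoad path g e * c e (edgeLoad path f e) := by
  have h : ∀ p, g p * pathCost path c f p =
      ∑ e, (if e ∈ path p then g p else 0) * c e (edgeLoad path f e) := by
    intro p
    simp only [pathCost, Finset.mul_sum, ite_mul, zero_mul, Finset.sum_ite_mem,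
      Finset.univ_inter]
  simp only [h]
  rw [Finset.sum_comm]
  simp only [edgeLoad, Finset.sum_mul]

/-- Variational inequality satisfied by a Wardrop equilibrium. -/
theorem IsWardrop.sum_mul_pathCost_le [Fintype P] [DecidableEq E] {path : P → Finset E}
    {c : E → ℝ → ℝ} {μ lam : ℝ} {f g : P → ℝ} (hf : IsWardrop path c μ f lam)
    (hg : Feasible g μ) :
    ∑ p, f p * pathCost path c f p ≤ ∑ p, g p * pathCost path c f p := by
  obtain ⟨⟨hf0, hfμ⟩, hused, hmin⟩ := hf
  calc ∑ p, f p * pathCost path c f p = ∑ p, f p * lam := by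
        refine Finset.sum_congr rfl fun p _ => ?_
        rcases (hf0 p).eq_or_lt with h | h
        · simp [← h]
        · rw [hused p h]
    _ = ∑ p, g p * lam := by rw [← Finset.sum_mul, ← Finset.sum_mul, hfμ, hg.2]
    _ ≤ ∑ p, g p * pathCost path c f p :=
        Finset.sum_le_sum fun p _ => mul_le_mul_of_nonneg_left (hmin p) (hg.1 p)

/-- With monotone costs, all Wardrop equilibria at a given demand induce the same edge costs. -/
theorem IsWardrop.edgeCost_eq [Fintype E] [Fintype P] [DecidableEq E] {path : P → Finset E}
    {c : E → ℝ → ℝ} (hc : ∀ e, Monotone (c e)) {μ lam lam' : ℝ} {f g : P → ℝ}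
    (hf : IsWardrop path c μ f lam) (hg : IsWardrop path c μ g lam') (e : E) :
    c e (edgeLoad path f e) = c e (edgeLoad path g e) := by
  have hfg := hf.sum_mul_pathCost_le hg.1
  have hgf := hg.sum_mul_pathCost_le hf.1
  simp only [sum_mul_pathCost] at hfg hgf
  have hnonneg : ∀ e ∈ Finset.univ, 0 ≤ (edgeLoad path f e - edgeLoad path g e) *
      (c e (edgeLoad path f e) - c e (edgeLoad path g e)) := by
    intro e _
    rcases le_total (edgeLoad path f e) (edgeLoad path g e) with h | h
    · exact mul_nonneg_of_nonpos_of_nonpos (sub_nonpos.2 h) (sub_nonpos.2 (hc e h))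
    · exact mul_nonneg (sub_nonneg.2 h) (sub_nonneg.2 (hc e h))
  have hsum : ∑ e, (edgeLoad path f e - edgeLoad path g e) *
      (c e (edgeLoad path f e) - c e (edgeLoad path g e)) = 0 := by
    refine le_antisymm ?_ (Finset.sum_nonneg hnonneg)
    simp only [sub_mul, mul_sub, Finset.sum_sub_distrib]
    linarith
  rcases mul_eq_zero.1 ((Finset.sum_eq_zero_iff_of_nonneg hnonneg).1 hsum e
    (Finset.mem_univ e)) with h | h
  · rw [sub_eq_zero.1 h]
  · exact sub_eq_zero.1 h

theorem IsWardrop.pathCost_eq [Fintype E] [Fintype P] [DecidableEq E] {path : P → Finset E}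
    {c : E → ℝ → ℝ} (hc : ∀ e, Monotone (c e)) {μ lam lam' : ℝ} {f g : P → ℝ}
    (hf : IsWardrop path c μ f lam) (hg : IsWardrop path c μ g lam') (p : P) :
    pathCost path c f p = pathCost path c g p :=
  Finset.sum_congr rfl fun e _ => hf.edgeCost_eq hc hg e

/-- At positive demand, some path attains the equilibrium cost. -/
theorem IsWardrop.exists_pathCost_eq [Fintype P] [DecidableEq E] {path : P → Finset E}
    {c : E → ℝ → ℝ} {μ lam : ℝ} {f : P → ℝ} (hμ : 0 < μ) (hf : IsWardrop path c μ f lam) :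
    ∃ p, pathCost path c f p = lam := by
  obtain ⟨p, -, hp⟩ := Finset.exists_lt_of_sum_lt
    (show ∑ _p : P, (0 : ℝ) < ∑ p, f p by simpa [hf.1.2] using hμ)
  exact ⟨p, hf.2.1 p hp⟩

/-- With monotone costs, the active network does not depend on the chosen equilibrium. -/
theorem IsWardrop.activeNet_eq [Fintype E] [Fintype P] [DecidableEq E] {path : P → Finset E}
    {c : E → ℝ → ℝ} (hc : ∀ e, Monotone (c e)) {μ lam lam' : ℝ} (hμ : 0 < μ) {f g : P → ℝ}
    (hf : IsWardrop path c μ f lam) (hg : IsWardrop path c μ g lam') :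
    activeNet path c f lam = activeNet path c g lam' := by
  have hcost : pathCost path c f = pathCost path c g :=
    funext fun p => hf.pathCost_eq hc hg p
  obtain ⟨p, hp⟩ := hf.exists_pathCost_eq hμ
  obtain ⟨q, hq⟩ := hg.exists_pathCost_eq hμ
  have hlam : lam = lam' :=
    le_antisymm (hq ▸ hcost ▸ hf.2.2 q) (hp ▸ hcost ▸ hg.2.2 p)
  simp only [activeNet, hcost, hlam]

/-- The three paths of the Wheatstone network. -/
def wheatstonePath : Fin 3 → Finset (Fin 5) := ![{0, 3}, {1, 4}, {0, 2, 4}]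

/-- The edge costs of the Wheatstone network with cost `c` on the two outer edges `1`, `3`. -/
def wheatstoneCost (c : ℝ → ℝ) : Fin 5 → ℝ → ℝ :=
  ![fun x => x, c, fun _ => 0, c, fun x => x]

theorem monotone_wheatstoneCost {c : ℝ → ℝ} (hc : Monotone c) (e : Fin 5) :
    Monotone (wheatstoneCost c e) := by
  fin_cases e
  exacts [monotone_id, hc, monotone_const, hc, monotone_id]

/-- Path costs when the demand `2 * x` is split evenly between the two outer paths. -/
theorem pathCost_wheatstone (c : ℝ → ℝ) (x : ℝ) :
    pathCost wheatstonePath (wheatstoneCost c) ![x, x, 0] = ![x + c x, c x + x, x + x] := by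
  funext p
  fin_cases p <;>
    simp [pathCost, edgeLoad, wheatstonePath, wheatstoneCost, Fin.sum_univ_three]

theorem isWardrop_wheatstone {c : ℝ → ℝ} {x : ℝ} (hx : 0 < x) (hcx : c x ≤ x) :
    IsWardrop wheatstonePath (wheatstoneCost c) (2 * x) ![x, x, 0] (x + c x) := by
  refine ⟨⟨fun p => ?_, ?_⟩, fun p => ?_, fun p => ?_⟩
  · fin_cases p <;> simp [hx.le]
  · simp [Fin.sum_univ_three, two_mul]
  · rw [pathCost_wheatstone]
    fin_cases p <;> simp [add_comm]
  · rw [pathCost_wheatstone]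
    fin_cases p <;> simp [add_comm, hcx]

/-- When `c x = x`, every edge is active at demand `2 * x`. -/
theorem activeNet_wheatstone_eq_univ {c : ℝ → ℝ} (hc : Monotone c) {x : ℝ} (hx : 0 < x)
    (hcx : c x = x) {f : Fin 3 → ℝ} {lam : ℝ}
    (hf : IsWardrop wheatstonePath (wheatstoneCost c) (2 * x) f lam) :
    activeNet wheatstonePath (wheatstoneCost c) f lam = Set.univ := by
  rw [hf.activeNet_eq (monotone_wheatstoneCost hc) (by positivity)
    (isWardrop_wheatstone hx hcx.le)]
  simp only [activeNet, pathCost_wheatstone]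
  ext e
  fin_cases e <;> simp [Fin.exists_fin_succ, wheatstonePath, hcx]

/-- When `c x < x`, the middle edge is inactive at demand `2 * x`. -/
theorem two_notMem_activeNet_wheatstone {c : ℝ → ℝ} (hc : Monotone c) {x : ℝ} (hx : 0 < x)
    (hcx : c x < x) {f : Fin 3 → ℝ} {lam : ℝ}
    (hf : IsWardrop wheatstonePath (wheatstoneCost c) (2 * x) f lam) :
    2 ∉ activeNet wheatstonePath (wheatstoneCost c) f lam := by
  rw [hf.activeNet_eq (monotone_wheatstoneCost hc) (by positivity)
    (isWardrop_wheatstone hx hcx.le)]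
  simp only [activeNet, pathCost_wheatstone]
  simp [hcx.ne', Fin.exists_fin_succ, wheatstonePath]

/-- in the Wheatstone network with edges `e₁,…,e₅` (here `Fin 5`), paths
`{e₁,e₄}, {e₂,e₅}, {e₁,e₃,e₅}`, costs `c₁(x) = c₅(x) = x`, `c₃ = 0`, and `c₂ = c₄ = c`
for any continuous, nonnegative, nondecreasing `c` equal to `a` on `(-∞,ζ]` and to `b` on
`[ζ+η,∞)` with `0 < η < a < ζ < ζ+η < b`, an active network that is abandoned can
reappear: there are demands `0 < μ¹ < μ² < μ³` with `Ẽ(μ¹) = Ẽ(μ³) ≠ Ẽ(μ²)`. -/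
theorem active_network_can_reappear
    (a ζ η b : ℝ)
    (h1 : 0 < η) (h2 : η < a) (h3 : a < ζ) (h4 : ζ + η < b)
    (c : ℝ → ℝ)
    (hc_cont : Continuous c) (hc_mono : Monotone c) (hc_nonneg : ∀ x, 0 ≤ c x)
    (hca : ∀ x ≤ ζ, c x = a) (hcb : ∀ x, ζ + η ≤ x → c x = b)
    (path : Fin 3 → Finset (Fin 5))
    (hpath : path = ![{0, 3}, {1, 4}, {0, 2, 4}])
    (costs : Fin 5 → ℝ → ℝ)
    (hcosts : costs = ![fun x => x, c, fun _ => 0, c, fun x => x])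
    (feq : ℝ → Fin 3 → ℝ) (lamf : ℝ → ℝ)
    (hfeq : ∀ μ : ℝ, 0 < μ → IsWardrop path costs μ (feq μ) (lamf μ)) :
    ∃ μ₁ μ₂ μ₃ : ℝ, 0 < μ₁ ∧ μ₁ < μ₂ ∧ μ₂ < μ₃ ∧
      activeNet path costs (feq μ₁) (lamf μ₁) =
        activeNet path costs (feq μ₃) (lamf μ₃) ∧
      activeNet path costs (feq μ₂) (lamf μ₂) ≠
        activeNet path costs (feq μ₁) (lamf μ₁) := by
  subst hpath hcosts
  have ha : 0 < a := h1.trans h2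
  have hm : c ((a + ζ) / 2) = a := hca _ (by linarith)
  refine ⟨2 * a, 2 * ((a + ζ) / 2), 2 * b, by linarith, by linarith, by linarith, ?_, ?_⟩
  · exact (activeNet_wheatstone_eq_univ hc_mono ha (hca a h3.le) (hfeq _ (by linarith))).trans
      (activeNet_wheatstone_eq_univ hc_mono (by linarith) (hcb b h4.le)
        (hfeq _ (by linarith))).symm
  · intro h
    refine two_notMem_activeNet_wheatstone hc_mono (x := (a + ζ) / 2) (by linarith)
      (by linarith) (hfeq _ (by linarith)) ?_
    exact (h.trans (activeNet_wheatstone_eq_univ hc_mono ha (hca a h3.le)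
      (hfeq _ (by linarith)))) ▸ Set.mem_univ _
end
end
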